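/- Let T = ℤ^17 with Gram matrix G of U⊕U⊕E_8⊕A_1^5, with e,f the basis of the first U block and r_1,…,r_5 the A_1 basis vectors, and let Γ* = {P ∈ O(T) : the induced automorphism of T*/T fixes the class of r_1/2}. Then Γ* has exactly three orbits on the set of primitive isotropic vectors of T, with representatives e, 2(e+f)+r_1+r_2+r_3+r_4, and 2(e+f)+r_2+r_3+r_4+r_5: every nonzero primitive v ∈ ℤ^17 with vᵀGv = 0 is Γ*-equivalent to exactly one of these three vectors. -/

import Mathlib

open Matrix

/-- Gram matrix of the hyperbolic plane `U`. -/
def gramU : Matrix (Fin 2) (Fin 2) ℤ := !![0, 1; 1, 0]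

/-- Gram matrix of the negative definite root lattice whose Dynkin diagram is a chain
on nodes `0, …, n-2` together with an extra node `n-1` attached to node `k`;
for `E₈` the chain has 7 nodes and the extra node is attached to node `2`. -/
def gramRoot (n k : ℕ) : Matrix (Fin n) (Fin n) ℤ :=
  Matrix.of fun i j =>
    if i = j then -2
    else if (((i : ℕ) + 1 = j ∨ (j : ℕ) + 1 = i) ∧ (i : ℕ) + 1 ≠ n ∧ (j : ℕ) + 1 ≠ n) ∨
        ((i : ℕ) + 1 = n ∧ (j : ℕ) = k) ∨ ((j : ℕ) + 1 = n ∧ (i : ℕ) = k) then 1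
    else 0

/-- Gram matrix of the standard negative definite root lattice `E₈`. -/
def gramE8 : Matrix (Fin 8) (Fin 8) ℤ := gramRoot 8 2

/-- Orthogonal (block diagonal) sum of two Gram matrices. -/
def blockSum {m n : ℕ} (A : Matrix (Fin m) (Fin m) ℤ) (B : Matrix (Fin n) (Fin n) ℤ) :
    Matrix (Fin (m + n)) (Fin (m + n)) ℤ :=
  Matrix.of fun i j =>
    if hi : (i : ℕ) < m then
      if hj : (j : ℕ) < m then A ⟨i, hi⟩ ⟨j, hj⟩ else 0
    else
      if hj : (j : ℕ) < m then 0
      else B ⟨(i : ℕ) - m, by have := i.isLt; omega⟩ ⟨(j : ℕ) - m, by have := j.isLt; omega⟩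

/-- Gram matrix of `T = U ⊕ U ⊕ E₈ ⊕ A₁⁵` (coordinates: `e, f` at indices 0,1;
the second copy of `U` at indices 2,3; `E₈` at indices 4–11; `r₁, …, r₅` at indices 12–16). -/
def gramT : Matrix (Fin 17) (Fin 17) ℤ :=
  blockSum gramU (blockSum gramU (blockSum gramE8 (Matrix.diagonal fun _ : Fin 5 => (-2 : ℤ))))

/-- `P` is an isometry of the lattice `(ℤⁿ, G)`, i.e. `P ∈ GL(n, ℤ)` with `Pᵀ G P = G`. -/
def IsIsometry {n : ℕ} (G P : Matrix (Fin n) (Fin n) ℤ) : Prop :=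
  IsUnit P.det ∧ Pᵀ * G * P = G

/-- The basis vector `e` of the first copy of `U` in `T`. -/
def eU : Fin 17 → ℤ := Pi.single 0 1

/-- The basis vector `f` of the first copy of `U` in `T`. -/
def fU : Fin 17 → ℤ := Pi.single 1 1

/-- The basis vectors `r₁, …, r₅` of the five copies of `A₁` in `T`. -/
def rA (k : Fin 5) : Fin 17 → ℤ := Pi.single ⟨12 + (k : ℕ), by have := k.isLt; omega⟩ 1

/-- `r` and `r'` lie in the same `O(T)`-orbit. -/
def OrbEquiv (v r : Fin 17 → ℤ) : Prop :=
  ∃ P : Matrix (Fin 17) (Fin 17) ℤ, IsIsometry gramT P ∧ P.mulVec v = r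

/-- A vector of `ℤⁿ` is primitive if the gcd of its coordinates is `1`. -/
def IsPrimitiveVec {n : ℕ} (v : Fin n → ℤ) : Prop :=
  ∀ d : ℤ, (∀ i, d ∣ v i) → IsUnit d

/-- `P` belongs to `Γ* ⊆ O(T)`: it is an isometry of `T` whose induced automorphism of
the discriminant group `T*/T` fixes the class of `r₁/2`, i.e. `P r₁ ≡ r₁ mod 2ℤ¹⁷`. -/
def MemGammaStar (P : Matrix (Fin 17) (Fin 17) ℤ) : Prop :=
  IsIsometry gramT P ∧ ∀ i, (2 : ℤ) ∣ (P.mulVec (rA 0) - rA 0) i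

/-- The three `Γ*`-orbit representatives `e`, `2(e+f)+r₁+r₂+r₃+r₄` and
`2(e+f)+r₂+r₃+r₄+r₅`. -/
def reps : Fin 3 → (Fin 17 → ℤ) :=
  ![eU, 2 • (eU + fU) + rA 0 + rA 1 + rA 2 + rA 3, 2 • (eU + fU) + rA 1 + rA 2 + rA 3 + rA 4]

def invE8 : Matrix (Fin 8) (Fin 8) ℤ := !![-4, -7, -10, -8, -6, -4, -2, -5; -7, -14, -20, -16, -12, -8, -4, -10; -10, -20, -30, -24, -18, -12, -6, -15; -8, -16, -24, -20, -15, -10, -5, -12; -6, -12, -18, -15, -12, -8, -4, -9; -4, -8, -12, -10, -8, -6, -3, -6; -2, -4, -6, -5, -4, -3, -2, -3; -5, -10, -15, -12, -9, -6, -3, -8]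

def invT : Matrix (Fin 17) (Fin 17) ℤ :=
  blockSum (2 • gramU) (blockSum (2 • gramU) (blockSum (2 • invE8)
    (Matrix.diagonal fun _ : Fin 5 => (-1 : ℤ))))

lemma invT_mul : invT * gramT = (2 : ℤ) • (1 : Matrix (Fin 17) (Fin 17) ℤ) := by
  ext i j
  revert i j
  decide +kernel

def entT (i j : Fin 17) : ℤ := gramT i j

lemma gramT_symm : gramTᵀ = gramT := by
  have h : ∀ i j : Fin 17, entT j i = entT i j := by decide +kernel
  ext i j
  exact h i j

lemma dvd_dot (d : ℤ) (x y : Fin 17 → ℤ) (h : ∀ j, d ∣ y j) : d ∣ x ⬝ᵥ y :=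
  Finset.dvd_sum fun j _ => (h j).mul_left _

def BT (x y : Fin 17 → ℤ) : ℤ := x ⬝ᵥ gramT.mulVec y

lemma BT_comm (x y) : BT x y = BT y x := by
  unfold BT
  rw [dotProduct_mulVec, ← mulVec_transpose, gramT_symm, dotProduct_comm]

lemma BT_add (x y z) : BT x (y + z) = BT x y + BT x z := by
  simp [BT, mulVec_add]
lemma BT_smul (c : ℤ) (x y) : BT x (c • y) = c * BT x y := by
  rw [BT, mulVec_smul, dotProduct_smul, smul_eq_mul, BT]
lemma BT_neg (x y) : BT x (-y) = - BT x y := by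
  simp [BT, mulVec_neg]
lemma BT_sub (x y z) : BT x (y - z) = BT x y - BT x z := by
  simp [BT, mulVec_sub]
lemma BT_add' (x y z) : BT (y + z) x = BT y x + BT z x := by
  simp [BT]
lemma BT_smul' (c : ℤ) (x y) : BT (c • y) x = c * BT y x := by
  rw [BT, smul_dotProduct, smul_eq_mul, BT]
lemma BT_neg' (x y) : BT (-y) x = - BT y x := by
  simp [BT]
lemma BT_sub' (x y z) : BT (y - z) x = BT y x - BT z x := by
  simp [BT]
lemma BT_single (j : Fin 17) (x) : BT (Pi.single j 1) x = gramT.mulVec x j := by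
  simp [BT]

def matT : Matrix (Fin 17) (Fin 17) ℤ := !![
    0, 1, 0, 0, 0, 0, 0, 0, 0, 0, 0, 0, 0, 0, 0, 0, 0;
    1, 0, 0, 0, 0, 0, 0, 0, 0, 0, 0, 0, 0, 0, 0, 0, 0;
    0, 0, 0, 1, 0, 0, 0, 0, 0, 0, 0, 0, 0, 0, 0, 0, 0;
    0, 0, 1, 0, 0, 0, 0, 0, 0, 0, 0, 0, 0, 0, 0, 0, 0;
    0, 0, 0, 0, -2, 1, 0, 0, 0, 0, 0, 0, 0, 0, 0, 0, 0;
    0, 0, 0, 0, 1, -2, 1, 0, 0, 0, 0, 0, 0, 0, 0, 0, 0;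
    0, 0, 0, 0, 0, 1, -2, 1, 0, 0, 0, 1, 0, 0, 0, 0, 0;
    0, 0, 0, 0, 0, 0, 1, -2, 1, 0, 0, 0, 0, 0, 0, 0, 0;
    0, 0, 0, 0, 0, 0, 0, 1, -2, 1, 0, 0, 0, 0, 0, 0, 0;
    0, 0, 0, 0, 0, 0, 0, 0, 1, -2, 1, 0, 0, 0, 0, 0, 0;
    0, 0, 0, 0, 0, 0, 0, 0, 0, 1, -2, 0, 0, 0, 0, 0, 0;
    0, 0, 0, 0, 0, 0, 1, 0, 0, 0, 0, -2, 0, 0, 0, 0, 0;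
    0, 0, 0, 0, 0, 0, 0, 0, 0, 0, 0, 0, -2, 0, 0, 0, 0;
    0, 0, 0, 0, 0, 0, 0, 0, 0, 0, 0, 0, 0, -2, 0, 0, 0;
    0, 0, 0, 0, 0, 0, 0, 0, 0, 0, 0, 0, 0, 0, -2, 0, 0;
    0, 0, 0, 0, 0, 0, 0, 0, 0, 0, 0, 0, 0, 0, 0, -2, 0;
    0, 0, 0, 0, 0, 0, 0, 0, 0, 0, 0, 0, 0, 0, 0, 0, -2]

lemma gramT_mulVec (x : Fin 17 → ℤ) : gramT.mulVec x =
    ![x 1, x 0, x 3, x 2,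
      -2 * x 4 + x 5, x 4 - 2 * x 5 + x 6, x 5 - 2 * x 6 + x 7 + x 11, x 6 - 2 * x 7 + x 8,
      x 7 - 2 * x 8 + x 9, x 8 - 2 * x 9 + x 10, x 9 - 2 * x 10, x 6 - 2 * x 11,
      -2 * x 12, -2 * x 13, -2 * x 14, -2 * x 15, -2 * x 16] := by
  have h : gramT = matT := by
    have h : ∀ i j : Fin 17, entT i j = (fun i j => matT i j : Fin 17 → Fin 17 → ℤ) i j := by decide +kernel
    ext i j
    exact h i j
  rw [h]
  ext i
  fin_cases i <;>
  · simp [matT, mulVec, dotProduct, Fin.sum_univ_succ]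
    try ring

lemma BT_formula (x y : Fin 17 → ℤ) : BT x y =
    x 0 * y 1 + x 1 * y 0 + x 2 * y 3 + x 3 * y 2 +
    x 4 * (-2 * y 4 + y 5) + x 5 * (y 4 - 2 * y 5 + y 6) + x 6 * (y 5 - 2 * y 6 + y 7 + y 11)
    + x 7 * (y 6 - 2 * y 7 + y 8) + x 8 * (y 7 - 2 * y 8 + y 9) + x 9 * (y 8 - 2 * y 9 + y 10)
    + x 10 * (y 9 - 2 * y 10) + x 11 * (y 6 - 2 * y 11)
    - 2 * (x 12 * y 12 + x 13 * y 13 + x 14 * y 14 + x 15 * y 15 + x 16 * y 16) := by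
  unfold BT
  rw [gramT_mulVec]
  simp [dotProduct, Fin.sum_univ_succ]
  ring

lemma BT_even (x) : ∃ q, BT x x = 2 * q := by
  refine ⟨x 0 * x 1 + x 2 * x 3 - x 4 ^ 2 - x 5 ^ 2 - x 6 ^ 2 - x 7 ^ 2 - x 8 ^ 2 - x 9 ^ 2
    - x 10 ^ 2 - x 11 ^ 2 - x 12 ^ 2 - x 13 ^ 2 - x 14 ^ 2 - x 15 ^ 2 - x 16 ^ 2
    + x 4 * x 5 + x 5 * x 6 + x 6 * x 7 + x 7 * x 8 + x 8 * x 9 + x 9 * x 10 + x 6 * x 11, ?_⟩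
  rw [BT_formula]
  ring

lemma BT_mulVec {P} (hP : IsIsometry gramT P) (x y) : BT (P.mulVec x) (P.mulVec y) = BT x y := by
  unfold BT
  rw [mulVec_mulVec, ← vecMul_transpose, ← dotProduct_mulVec, mulVec_mulVec, ← Matrix.mul_assoc,
    hP.2]

lemma mem_mul {P Q} (hP : MemGammaStar P) (hQ : MemGammaStar Q) : MemGammaStar (P * Q) := by
  refine ⟨⟨?_, ?_⟩, ?_⟩
  · rw [det_mul]; exact hP.1.1.mul hQ.1.1
  · have : (P * Q)ᵀ * gramT * (P * Q) = Qᵀ * (Pᵀ * gramT * P) * Q := by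
      simp only [transpose_mul, Matrix.mul_assoc]
    rw [this, hP.1.2, hQ.1.2]
  · choose t ht using hQ.2
    have h : Q.mulVec (rA 0) = rA 0 + (2 : ℤ) • t := by
      ext i
      have := ht i
      simp at this ⊢
      linarith
    intro i
    obtain ⟨s, hs⟩ := hP.2 i
    refine ⟨s + P.mulVec t i, ?_⟩
    rw [← mulVec_mulVec, h, mulVec_add, mulVec_smul]
    simp at hs ⊢
    linarith

lemma mem_inv {P} (hP : MemGammaStar P) : MemGammaStar P⁻¹ := by
  have h1 : P * P⁻¹ = 1 := Matrix.mul_nonsing_inv _ hP.1.1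
  have h2 : P⁻¹ * P = 1 := Matrix.nonsing_inv_mul _ hP.1.1
  refine ⟨⟨?_, ?_⟩, ?_⟩
  · exact Matrix.isUnit_nonsing_inv_det _ hP.1.1
  · calc P⁻¹ᵀ * gramT * P⁻¹ = P⁻¹ᵀ * (Pᵀ * gramT * P) * P⁻¹ := by rw [hP.1.2]
      _ = (P * P⁻¹)ᵀ * gramT * (P * P⁻¹) := by simp only [transpose_mul, Matrix.mul_assoc]
      _ = gramT := by rw [h1]; simp
  · choose t ht using hP.2
    have h : rA 0 = P.mulVec (rA 0) - (2 : ℤ) • t := by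
      ext i
      have := ht i
      simp at this ⊢
      linarith
    intro i
    refine ⟨- (P⁻¹.mulVec t i), ?_⟩
    have h3 : P⁻¹.mulVec (rA 0) = rA 0 - (2 : ℤ) • P⁻¹.mulVec t := by
      conv_lhs => rw [h]
      rw [mulVec_sub, mulVec_smul, mulVec_mulVec, h2, one_mulVec]
    rw [h3]
    simp

def RelG (x y : Fin 17 → ℤ) : Prop :=
  ∃ P : Matrix (Fin 17) (Fin 17) ℤ, MemGammaStar P ∧ P.mulVec x = y

lemma RelG.trans {x y z} (h : RelG x y) (h' : RelG y z) : RelG x z := by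
  obtain ⟨P, hP, rfl⟩ := h
  obtain ⟨Q, hQ, rfl⟩ := h'
  exact ⟨Q * P, mem_mul hQ hP, by simp⟩

lemma RelG.symm {x y} (h : RelG x y) : RelG y x := by
  obtain ⟨P, hP, rfl⟩ := h
  exact ⟨P⁻¹, mem_inv hP, by rw [mulVec_mulVec, Matrix.nonsing_inv_mul _ hP.1.1, one_mulVec]⟩

lemma RelG.BT_self {x y} (h : RelG x y) : BT y y = BT x x := by
  obtain ⟨P, hP, rfl⟩ := h
  exact BT_mulVec hP.1 _ _

lemma RelG.prim {x y} (h : RelG x y) (hx : IsPrimitiveVec x) : IsPrimitiveVec y := by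
  obtain ⟨P, hP, rfl⟩ := h.symm
  intro d hd
  apply hx
  intro i
  exact dvd_dot d (P i) y hd

lemma relG_of_linear (φ ψ : (Fin 17 → ℤ) →ₗ[ℤ] (Fin 17 → ℤ)) (h1 : ∀ x, φ (ψ x) = x)
    (hB : ∀ x y, BT (φ x) (φ y) = BT x y) (hr : ∀ i, (2 : ℤ) ∣ (φ (rA 0) - rA 0) i) (x) :
    RelG x (φ x) := by
  have hm : ∀ y, (LinearMap.toMatrix' φ).mulVec y = φ y := fun y => by
    rw [← Matrix.toLin'_apply, Matrix.toLin'_toMatrix']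
  refine ⟨LinearMap.toMatrix' φ, ⟨⟨?_, ?_⟩, ?_⟩, hm x⟩
  · have : LinearMap.toMatrix' φ * LinearMap.toMatrix' ψ = 1 := by
      rw [← LinearMap.toMatrix'_comp, ← LinearMap.toMatrix'_id]
      congr 1
      exact LinearMap.ext h1
    have h := congrArg det this
    rw [det_mul, det_one] at h
    exact IsUnit.of_mul_eq_one _ h
  · ext i j
    have h := hB (Pi.single i 1) (Pi.single j 1)
    rw [← hm, ← hm] at h
    unfold BT at h
    rw [mulVec_mulVec, ← vecMul_transpose, ← dotProduct_mulVec, mulVec_mulVec, ← Matrix.mul_assoc]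
      at h
    simpa using h
  · rw [hm]; exact hr

lemma relG_perm (σ : Equiv.Perm (Fin 17)) (hσ : ∀ i j, entT (σ i) (σ j) = entT i j)
    (h12 : σ 12 = 12) (x) : RelG x (x ∘ σ) := by
  refine relG_of_linear (LinearMap.funLeft ℤ ℤ σ) (LinearMap.funLeft ℤ ℤ σ.symm) ?_ ?_ ?_ x
  · intro x
    ext i
    simp [LinearMap.funLeft]
  · intro x y
    simp only [BT, dotProduct, mulVec, LinearMap.funLeft_apply]
    rw [← Equiv.sum_comp σ (fun i => x i * ∑ j, gramT i j * y j)]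
    refine Finset.sum_congr rfl fun i _ => ?_
    congr 1
    rw [← Equiv.sum_comp σ (fun j => gramT (σ i) j * y j)]
    exact Finset.sum_congr rfl fun j _ => by
      have := hσ i j
      unfold entT at this
      rw [this]
  · intro i
    have : (LinearMap.funLeft ℤ ℤ σ) (rA 0) = rA 0 := by
      ext i
      have h : rA 0 = Pi.single (12 : Fin 17) (1 : ℤ) := rfl
      rw [LinearMap.funLeft_apply, h]
      by_cases hi : i = 12
      · rw [hi, h12]
      · have : σ i ≠ 12 := fun h => hi (σ.injective (h.trans h12.symm))
        simp [hi, this]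
    rw [this]
    simp

lemma relG_neg (x) : RelG x (-x) := by
  have := relG_of_linear (-LinearMap.id) (-LinearMap.id) (by simp)
    (by intro x y; simp [BT_neg, BT_neg']) (by intro i; exact ⟨- rA 0 i, by simp; ring⟩) x
  simpa using this

def psi (u a : Fin 17 → ℤ) (q : ℤ) : (Fin 17 → ℤ) →ₗ[ℤ] (Fin 17 → ℤ) where
  toFun x := x - BT a x • u + BT u x • a - (q * BT u x) • u
  map_add' x y := by
    simp only [BT_add]
    module
  map_smul' c x := by
    simp only [BT_smul, RingHom.id_apply]
    module

lemma BT_r (x) : BT x (rA 0) = -2 * x 12 := by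
  rw [BT_comm]
  have h : rA 0 = Pi.single (12 : Fin 17) (1 : ℤ) := rfl
  rw [h, BT_single, gramT_mulVec]
  rfl

lemma relG_psi (u a : Fin 17 → ℤ) (q : ℤ) (hu : BT u u = 0) (hua : BT u a = 0)
    (ha : BT a a = 2 * q) (x) :
    RelG x (x - BT a x • u + BT u x • a - (q * BT u x) • u) := by
  have hau : BT a u = 0 := by rw [BT_comm, hua]
  refine relG_of_linear (psi u a q) (psi u (-a) q) ?_ ?_ ?_ x
  · intro x
    simp only [psi, LinearMap.coe_mk, AddHom.coe_mk, BT_add, BT_sub, BT_smul, BT_neg, BT_neg',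
      hu, hua, hau, ha]
    module
  · intro x y
    simp only [psi, LinearMap.coe_mk, AddHom.coe_mk, BT_add, BT_sub, BT_smul, BT_neg, BT_neg',
      BT_add', BT_sub', BT_smul', hu, hua, hau, ha, BT_comm x a, BT_comm x u]
    ring
  · intro i
    simp only [psi, LinearMap.coe_mk, AddHom.coe_mk, BT_r]
    refine ⟨a 12 * u i - u 12 * a i + q * u 12 * u i, ?_⟩
    simp
    ring

/-- Add `w 0 * x` to the coordinates of index at least two. -/
lemma relG_shift (w x : Fin 17 → ℤ) (h0 : x 0 = 0) : ∃ q : ℤ,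
    RelG w (w + w 0 • x - (BT x w + q * w 0) • Pi.single 1 1) := by
  obtain ⟨q, hq⟩ := BT_even x
  refine ⟨q, ?_⟩
  have hf : ∀ y, BT (Pi.single 1 1) y = y 0 := fun y => by rw [BT_single, gramT_mulVec]; rfl
  have := relG_psi (Pi.single 1 1) x q (by rw [hf]; rfl) (by rw [hf, h0]) hq w
  rw [hf] at this
  convert this using 1
  module

lemma relG_into (w : Fin 17 → ℤ) (h3 : w 3 = 0) (j : Fin 17) (hj : j ≠ 3) :
    RelG w (w - gramT.mulVec w j • Pi.single 2 1) := by
  have hf : ∀ y, BT (Pi.single 2 1) y = y 3 := fun y => by rw [BT_single, gramT_mulVec]; rfl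
  obtain ⟨q, hq⟩ := BT_even (Pi.single j 1)
  have := relG_psi (Pi.single 2 1) (Pi.single j 1) q (by rw [hf]; rfl)
    (by rw [hf]; simp [hj.symm]) hq w
  rw [hf, h3, BT_single] at this
  simpa using this

lemma relG_swap01 (x) : RelG x (x ∘ Equiv.swap 0 1) :=
  relG_perm _ (by decide +kernel) (by decide) x
lemma relG_swap23 (x) : RelG x (x ∘ Equiv.swap 2 3) :=
  relG_perm _ (by decide +kernel) (by decide) x
lemma relG_swapU (x) : RelG x (x ∘ (Equiv.swap 0 2 * Equiv.swap 1 3 : Equiv.Perm (Fin 17))) :=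
  relG_perm _ (by decide +kernel) (by decide) x
lemma relG_swapA (j : Fin 17) (hj : 13 ≤ j) (x) : RelG x (x ∘ Equiv.swap j 16) :=
  relG_perm _ (by revert j; decide +kernel) (by revert j; decide +kernel) x

lemma exists_ne_coord (v : Fin 17 → ℤ) (hv : v ≠ 0) : ∃ u, RelG v u ∧ u 0 ≠ 0 := by
  by_cases h0 : v 0 = 0
  swap
  · exact ⟨_, (relG_neg v), by simpa using h0⟩
  by_cases h1 : v 1 = 0
  swap
  · exact ⟨_, relG_swap01 v, by simpa using h1⟩
  have key : ∀ w : Fin 17 → ℤ, w 2 ≠ 0 → ∃ u, RelG w u ∧ u 0 ≠ 0 := fun w hw =>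
    ⟨_, relG_swapU w, hw⟩
  by_cases h2 : v 2 = 0
  swap
  · exact key v h2
  by_cases h3 : v 3 = 0
  swap
  · obtain ⟨u, hu, h⟩ := key _ (by simpa using h3 : (v ∘ Equiv.swap 2 3) 2 ≠ 0)
    exact ⟨u, (relG_swap23 v).trans hu, h⟩
  have : ∃ j, gramT.mulVec v j ≠ 0 := by
    by_contra! hcon
    apply hv
    have hg : gramT.mulVec v = 0 := funext hcon
    have h := congrArg invT.mulVec hg
    rw [mulVec_mulVec, invT_mul, mulVec_zero, smul_mulVec, one_mulVec] at h
    exact (smul_eq_zero.mp h).resolve_left two_ne_zero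
  obtain ⟨j, hj⟩ := this
  have hj3 : j ≠ 3 := by
    rintro rfl
    rw [gramT_mulVec] at hj
    exact hj h2
  obtain ⟨u, hu, h⟩ := key (v - gramT.mulVec v j • Pi.single 2 1) (by simp [h2, hj])
  exact ⟨u, (relG_into v h3 j hj3).trans hu, h⟩

lemma exists_dvd_form (v : Fin 17 → ℤ) (hv : v ≠ 0) :
    ∃ w, RelG v w ∧ 0 < w 0 ∧ ∀ j, w 0 ∣ gramT.mulVec w j := by
  classical
  have hex : ∃ n : ℕ, 0 < n ∧ ∃ u, RelG v u ∧ u 0 = n := by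
    obtain ⟨u, hu, h0⟩ := exists_ne_coord v hv
    rcases lt_or_gt_of_ne h0 with h | h
    · exact ⟨(-u 0).toNat, by omega, -u, hu.trans (relG_neg u), by rw [Pi.neg_apply]; omega⟩
    · exact ⟨(u 0).toNat, by omega, u, hu, by omega⟩
  obtain ⟨hpos, w, hw, hw0⟩ := Nat.find_spec hex
  have hmin := fun m => Nat.find_min hex (m := m)
  set n := Nat.find hex
  have key : ∀ u, RelG v u → u 0 = n → (n : ℤ) ∣ u 2 := by
    intro u hu hu0
    by_contra hnd
    obtain ⟨q, hq⟩ := relG_shift u ((-(u 2 / n)) • Pi.single 2 1) (by simp)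
    have h2 := (hu.trans hq).trans (relG_swapU _)
    have hpos' : (0 : ℤ) < n := by exact_mod_cast hpos
    have hlt := Int.emod_lt_of_pos (u 2) hpos'
    have hnn := Int.emod_nonneg (u 2) hpos'.ne'
    have hne : u 2 % n ≠ 0 := fun h => hnd (Int.dvd_of_emod_eq_zero h)
    have hm := Int.emod_def (u 2) n
    refine hmin (u 2 % n).toNat (by omega) ⟨by omega, _, h2, ?_⟩
    rw [Int.toNat_of_nonneg hnn, hm]
    have hs : (Equiv.swap 0 2 * Equiv.swap 1 3 : Equiv.Perm (Fin 17)) 0 = 2 := by decide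
    rw [Function.comp_apply, hs]
    simp [hu0]
    ring
  have d2 := key w hw hw0
  have d3 : (n : ℤ) ∣ w 3 := by
    have := key _ (hw.trans (relG_swap23 w)) hw0
    simpa using this
  obtain ⟨s, hs⟩ := d2
  obtain ⟨t, ht⟩ := d3
  obtain ⟨q, hq⟩ := relG_shift w (-s • Pi.single 2 1 - t • Pi.single 3 1) (by simp)
  set w' := _ + _ - (_ : Fin 17 → ℤ) with hw'
  have e0 : w' 0 = n := by simp [hw', hw0]
  have e2 : w' 2 = 0 := by simp [hw', hw0, hs]
  have e3 : w' 3 = 0 := by simp [hw', hw0, ht]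
  refine ⟨w', hw.trans hq, by rw [e0]; exact_mod_cast hpos, fun j => ?_⟩
  rw [e0]
  by_cases hj : j = 3
  · rw [hj, gramT_mulVec]
    change (n : ℤ) ∣ w' 2
    simp [e2]
  have := key _ ((hw.trans hq).trans (relG_into w' e3 j hj)) (by simp [e0])
  simpa [e2] using this

lemma int_cases (b x y z t s : ℤ) (hb : 2 ∣ b) (hx : x = 0 ∨ x = 1) (hy : y = 0 ∨ y = 1)
    (hz : z = 0 ∨ z = 1) (ht : t = 0 ∨ t = 1) (hs : s = 0 ∨ s = 1)
    (h : 2 * b = x * x + y * y + z * z + t * t + s * s) :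
    (b = 0 ∧ x = 0 ∧ y = 0 ∧ z = 0 ∧ t = 0 ∧ s = 0) ∨
    (b = 2 ∧ x = 0 ∧ y = 1 ∧ z = 1 ∧ t = 1 ∧ s = 1) ∨
    (b = 2 ∧ x = 1 ∧ y = 0 ∧ z = 1 ∧ t = 1 ∧ s = 1) ∨
    (b = 2 ∧ x = 1 ∧ y = 1 ∧ z = 0 ∧ t = 1 ∧ s = 1) ∨
    (b = 2 ∧ x = 1 ∧ y = 1 ∧ z = 1 ∧ t = 0 ∧ s = 1) ∨
    (b = 2 ∧ x = 1 ∧ y = 1 ∧ z = 1 ∧ t = 1 ∧ s = 0) := by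
  rcases hx with rfl | rfl <;> rcases hy with rfl | rfl <;> rcases hz with rfl | rfl <;>
  rcases ht with rfl | rfl <;> rcases hs with rfl | rfl <;>
  first
  | (exfalso; omega)
  | (have hb2 : b = 0 ∨ b = 2 := by omega
     rcases hb2 with rfl | rfl <;> first | (exfalso; omega) | simp)

set_option maxHeartbeats 1000000 in
lemma normal_form (v : Fin 17 → ℤ) (hv : v ≠ 0) (hp : IsPrimitiveVec v) (hi : BT v v = 0) :
    ∃ k, RelG v (reps k) := by
  obtain ⟨w, hw, hpos, hd⟩ := exists_dvd_form v hv
  have hwp := hw.prim hp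
  have hwi : BT w w = 0 := by rw [hw.BT_self, hi]
  have hd2 : w 0 ∣ 2 := by
    have h2 : ∀ i, w 0 ∣ 2 * w i := by
      intro i
      have h : invT.mulVec (gramT.mulVec w) i = 2 * w i := by
        rw [mulVec_mulVec, invT_mul, smul_mulVec, one_mulVec]; simp
      rw [← h]
      exact dvd_dot _ (invT i) _ hd
    rcases Int.even_or_odd' (w 0) with ⟨c, hc | hc⟩
    · have : IsUnit c := hwp c fun i => by
        obtain ⟨t, ht⟩ := h2 i
        exact ⟨t, by rw [hc] at ht; linarith⟩
      rw [hc]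
      exact (mul_dvd_mul_left 2 this.dvd).trans (by simp : (2 : ℤ) * 1 ∣ 2)
    · have hco : IsCoprime (w 0) 2 := ⟨1, -c, by rw [hc]; ring⟩
      exact (hwp _ fun i => hco.dvd_of_dvd_mul_left (h2 i)).dvd
  have hle := Int.le_of_dvd two_pos hd2
  obtain h | h : w 0 = 1 ∨ w 0 = 2 := by omega
  · refine ⟨0, hw.trans ?_⟩
    obtain ⟨q, hq⟩ := relG_shift w (fun i => if i = 0 then 0 else if i = 1 then 0 else - w i)
      (by simp)
    set u := _ + _ - (_ : Fin 17 → ℤ) with hu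
    have hui : BT u u = 0 := by rw [hq.BT_self, hwi]
    have h0 : u 0 = 1 := by simp [hu, h]
    have hz : ∀ i, i ≠ 0 → i ≠ 1 → u i = 0 := by
      intro i hi0 hi1
      simp [hu, h, hi0, hi1]
    have h1 : u 1 = 0 := by
      rw [BT_formula, h0] at hui
      simp [hz] at hui
      linarith
    have : reps 0 = u := by
      ext i
      by_cases hi0 : i = 0
      · subst hi0; rw [h0]; rfl
      by_cases hi1 : i = 1
      · subst hi1; rw [h1]; rfl
      rw [hz i hi0 hi1]
      simp [reps, eU, hi0]
    rw [this]
    exact hq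
  · obtain ⟨q, hq⟩ := relG_shift w (fun i => if i = 0 then 0 else if i = 1 then 0 else - (w i / 2))
      (by simp)
    set u := _ + _ - (_ : Fin 17 → ℤ) with hu
    have hui : BT u u = 0 := by rw [hq.BT_self, hwi]
    have hup := hq.prim hwp
    have h0 : u 0 = 2 := by simp [hu, h]
    have hz : ∀ i, i ≠ 0 → i ≠ 1 → u i = w i % 2 := by
      intro i hi0 hi1
      simp [hu, h, hi0, hi1]
      omega
    rw [h, gramT_mulVec] at hd
    have a0 : (2 : ℤ) ∣ w 1 := hd 0
    have a2 : (2 : ℤ) ∣ w 3 := hd 2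
    have a3 : (2 : ℤ) ∣ w 2 := hd 3
    have a4 : (2 : ℤ) ∣ -2 * w 4 + w 5 := hd 4
    have a5 : (2 : ℤ) ∣ w 4 - 2 * w 5 + w 6 := hd 5
    have a6 : (2 : ℤ) ∣ w 5 - 2 * w 6 + w 7 + w 11 := hd 6
    have a7 : (2 : ℤ) ∣ w 6 - 2 * w 7 + w 8 := hd 7
    have a8 : (2 : ℤ) ∣ w 7 - 2 * w 8 + w 9 := hd 8
    have a9 : (2 : ℤ) ∣ w 8 - 2 * w 9 + w 10 := hd 9
    have a10 : (2 : ℤ) ∣ w 9 - 2 * w 10 := hd 10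
    have a11 : (2 : ℤ) ∣ w 6 - 2 * w 11 := hd 11
    have b2 : u 2 = 0 := by rw [hz 2 (by decide) (by decide)]; omega
    have b3 : u 3 = 0 := by rw [hz 3 (by decide) (by decide)]; omega
    have b4 : u 4 = 0 := by rw [hz 4 (by decide) (by decide)]; omega
    have b5 : u 5 = 0 := by rw [hz 5 (by decide) (by decide)]; omega
    have b6 : u 6 = 0 := by rw [hz 6 (by decide) (by decide)]; omega
    have b7 : u 7 = 0 := by rw [hz 7 (by decide) (by decide)]; omega
    have b8 : u 8 = 0 := by rw [hz 8 (by decide) (by decide)]; omega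
    have b9 : u 9 = 0 := by rw [hz 9 (by decide) (by decide)]; omega
    have b10 : u 10 = 0 := by rw [hz 10 (by decide) (by decide)]; omega
    have b11 : u 11 = 0 := by rw [hz 11 (by decide) (by decide)]; omega
    have hb : ∀ i, i ≠ 0 → i ≠ 1 → u i = 0 ∨ u i = 1 := by
      intro i hi0 hi1
      rw [hz i hi0 hi1]
      omega
    have b1 : (2 : ℤ) ∣ u 1 := by
      have hx : ∀ x, (2 : ℤ) ∣ BT x w := fun x => by
        refine dvd_dot _ _ _ fun j => ?_
        rw [gramT_mulVec]; exact hd j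
      have : u 1 = w 1 - (BT (fun i => if i = 0 then 0 else if i = 1 then 0 else - (w i / 2)) w
        + q * 2) := by simp [hu, h]
      rw [this]
      exact dvd_sub a0 (dvd_add (hx _) (Dvd.intro_left _ rfl))
    rw [BT_formula, h0, b2, b3, b4, b5, b6, b7, b8, b9, b10, b11] at hui
    have hwu := hw.trans hq
    have r1 : reps 1 = ![2, 2, 0, 0, 0, 0, 0, 0, 0, 0, 0, 0, 1, 1, 1, 1, 0] := by
      decide +kernel
    have r2 : reps 2 = ![2, 2, 0, 0, 0, 0, 0, 0, 0, 0, 0, 0, 0, 1, 1, 1, 1] := by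
      decide +kernel
    have hue : u = ![u 0, u 1, u 2, u 3, u 4, u 5, u 6, u 7, u 8, u 9, u 10, u 11, u 12, u 13,
        u 14, u 15, u 16] := by
      ext i; fin_cases i <;> rfl
    have c12 := hb 12 (by decide) (by decide)
    have c13 := hb 13 (by decide) (by decide)
    have c14 := hb 14 (by decide) (by decide)
    have c15 := hb 15 (by decide) (by decide)
    have c16 := hb 16 (by decide) (by decide)
    clear_value u
    rw [h0, b2, b3, b4, b5, b6, b7, b8, b9, b10, b11] at hue
    clear * - hui hue hup hwu r1 r2 b1 c12 c13 c14 c15 c16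
    rcases int_cases _ _ _ _ _ _ b1 c12 c13 c14 c15 c16 (by linarith) with
      ⟨hu1, c12, c13, c14, c15, c16⟩ | ⟨hu1, c12, c13, c14, c15, c16⟩ |
      ⟨hu1, c12, c13, c14, c15, c16⟩ | ⟨hu1, c12, c13, c14, c15, c16⟩ |
      ⟨hu1, c12, c13, c14, c15, c16⟩ | ⟨hu1, c12, c13, c14, c15, c16⟩ <;>
    rw [hu1, c12, c13, c14, c15, c16] at hue
    · exfalso
      have : IsUnit (2 : ℤ) := hup 2 fun i => by
        rw [hue]; revert i; decide
      exact absurd this (by decide)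
    all_goals
      rw [hue] at hwu
      clear * - hwu r1 r2
    · exact ⟨2, by rw [r2]; exact hwu⟩
    · refine ⟨1, ?_⟩
      convert hwu.trans (relG_swapA 13 (by decide) _) using 1
      rw [r1]; decide +kernel
    · refine ⟨1, ?_⟩
      convert hwu.trans (relG_swapA 14 (by decide) _) using 1
      rw [r1]; decide +kernel
    · refine ⟨1, ?_⟩
      convert hwu.trans (relG_swapA 15 (by decide) _) using 1
      rw [r1]; decide +kernel
    · exact ⟨1, by rw [r1]; exact hwu⟩

lemma reps_even (k : Fin 3) (hk : k ≠ 0) (x) : (2 : ℤ) ∣ BT x (reps k) := by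
  have : ∀ k : Fin 3, k ≠ 0 → ∀ j, (2 : ℤ) ∣ gramT.mulVec (reps k) j := by decide +kernel
  exact dvd_dot _ _ _ (this k hk)

lemma reps_zero (k : Fin 3) (h : RelG (reps 0) (reps k)) : k = 0 := by
  by_contra hk
  obtain ⟨P, hP, h⟩ := h
  have h1 := reps_even k hk (P.mulVec fU)
  rw [← h, BT_mulVec hP.1] at h1
  have e1 : BT fU (reps 0) = 1 := by unfold BT; decide +kernel
  omega

lemma reps_one_two (h : RelG (reps 1) (reps 2)) : False := by
  obtain ⟨P, hP, h⟩ := h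
  choose t ht using hP.2
  have h3 : P.mulVec (rA 0) = rA 0 + (2 : ℤ) • t := by
    ext i
    have := ht i
    simp at this ⊢
    linarith
  have h4 := BT_mulVec hP.1 (rA 0) (reps 1)
  obtain ⟨s, hs⟩ := reps_even 2 (by decide) t
  have e1 : BT (rA 0) (reps 1) = -2 := by unfold BT; decide +kernel
  have e2 : BT (rA 0) (reps 2) = 0 := by unfold BT; decide +kernel
  rw [h, h3, BT_add', BT_smul', hs, e1, e2] at h4
  omega

lemma reps_inj (j k : Fin 3) (h : RelG (reps j) (reps k)) : j = k := by
  by_cases hj : j = 0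
  · subst hj; exact (reps_zero k h).symm
  by_cases hk : k = 0
  · subst hk; exact reps_zero j h.symm
  fin_cases j <;> fin_cases k <;> first | rfl | exact absurd rfl hj | exact absurd rfl hk | skip
  · exact (reps_one_two h).elim
  · exact (reps_one_two h.symm).elim

/-- `Γ*` has exactly three orbits on the set of (nonzero) primitive isotropic vectors
of `T = U ⊕ U ⊕ E₈ ⊕ A₁⁵`, with representatives `e`, `2(e+f)+r₁+r₂+r₃+r₄` and
`2(e+f)+r₂+r₃+r₄+r₅`. -/
theorem GammaStar_orbits_on_primitive_isotropic (v : Fin 17 → ℤ) (hv0 : v ≠ 0)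
    (hvprim : IsPrimitiveVec v) (hviso : v ⬝ᵥ gramT.mulVec v = 0) :
    ∃! k : Fin 3, ∃ P : Matrix (Fin 17) (Fin 17) ℤ, MemGammaStar P ∧ P.mulVec (reps k) = v := by
  obtain ⟨k, hk⟩ := normal_form v hv0 hvprim hviso
  refine ⟨k, hk.symm, fun j hj => ?_⟩
  exact reps_inj j k (RelG.trans hj hk)
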